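/- Assume the positive gap condition holds, C_w < ∞, and the interval support condition holds with parameter W. Let (f_0, g_0) and (f_1, g_1) be consistent fixed points consisting of nondecreasing interpolating profiles, let (f_λ, g_λ) be their displacement interpolants, and define D(u,v) := (f_1^{-1}(v) - g_1^{-1}(u)) - (f_0^{-1}(v) - g_0^{-1}(u)). Then for every λ ∈ [0,1], the two-dimensional Lebesgue measure of the set { (u,v) ∈ (0,1)² : |f_λ^{-1}(v) - g_λ^{-1}(u)| < W, D(u,v) ≠ 0, φ(u,v) ≠ 0 } is zero. -/

import Mathlib

open MeasureTheory Filter Set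
open scoped ENNReal

noncomputable section

/-- Convolution `(p ⊗ w)(x) = ∫ p(y) w(x-y) dy`. -/
def convw (p w : ℝ → ℝ) (x : ℝ) : ℝ := ∫ y, p y * w (x - y)

/-- `w` is a window: bounded, nonnegative, even, integrable, normalized. -/
structure IsWindow (w : ℝ → ℝ) : Prop where
  nonneg : ∀ x, 0 ≤ w x
  even : ∀ x, w (-x) = w x
  bounded : ∃ M, ∀ x, w x ≤ M
  integrable : Integrable w
  normalized : (∫ x, w x) = 1

/-- Generalized inverse `h⁻¹(u) = inf {v ∈ [0,1] : h v > u}`. -/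
def geninv (h : ℝ → ℝ) (u : ℝ) : ℝ := sInf {v | v ∈ Icc (0:ℝ) 1 ∧ u < h v}

/-- `h` is an update function: nondecreasing from [0,1] to [0,1] with h 0 = 0, h 1 = 1. -/
def IsUpdate (h : ℝ → ℝ) : Prop :=
  MonotoneOn h (Icc (0:ℝ) 1) ∧ (∀ v ∈ Icc (0:ℝ) 1, h v ∈ Icc (0:ℝ) 1) ∧ h 0 = 0 ∧ h 1 = 1

/-- The potential function φ(u,v). -/
def pot (hf hg : ℝ → ℝ) (u v : ℝ) : ℝ :=
  (∫ u' in (0:ℝ)..u, geninv hg u') + (∫ v' in (0:ℝ)..v, geninv hf v') - u * v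

/-- The positive gap condition. -/
def PGC (hf hg : ℝ → ℝ) : Prop :=
  pot hf hg 1 1 = 0 ∧ ∀ u ∈ Icc (0:ℝ) 1, ∀ v ∈ Icc (0:ℝ) 1, 0 ≤ pot hf hg u v

/-- The strictly positive gap condition. -/
def SPGC (hf hg : ℝ → ℝ) : Prop :=
  pot hf hg 1 1 = 0 ∧ ∀ u ∈ Icc (0:ℝ) 1, ∀ v ∈ Icc (0:ℝ) 1,
    (u, v) ≠ ((0:ℝ), (0:ℝ)) → (u, v) ≠ ((1:ℝ), (1:ℝ)) → 0 < pot hf hg u v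

/-- Interpolating profile: takes values in [0,1], tends to 0 at -∞ and to 1 at +∞. -/
def IsProfile (p : ℝ → ℝ) : Prop :=
  (∀ x, p x ∈ Icc (0:ℝ) 1) ∧ Tendsto p atBot (nhds 0) ∧ Tendsto p atTop (nhds 1)

/-- `H(t) = ∫_0^t h⁻¹`. -/
def Hfun (h : ℝ → ℝ) (t : ℝ) : ℝ := ∫ v in (0:ℝ)..t, geninv h v

/-- The potential functional `W(f,g)`, valued in [0,∞]. -/
def Wfun (w hf hg f g : ℝ → ℝ) : ℝ≥0∞ :=
  ∫⁻ x, ENNReal.ofReal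
    (Hfun hg (g x) + convw (fun y => Hfun hf (f y)) w x - convw f w x * g x)

/-- Saturation of a profile `f` at level `K`. -/
def cut (f : ℝ → ℝ) (K : ℝ) (x : ℝ) : ℝ :=
  (if |x| ≤ K then f x else 0) + (if K < x then 1 else 0)

/-- Left endpoint of the maximal half-line contained in the level set `{x : p x > t}`. -/
def aT (p : ℝ → ℝ) (t : ℝ) : ℝ := sInf {a : ℝ | Ioi a ⊆ {x | t < p x}}

/-- Increasing rearrangement of an interpolating profile. -/
def rearr (p : ℝ → ℝ) (x : ℝ) : ℝ :=
  (volume {t : ℝ | t ∈ Ioo (0:ℝ) 1 ∧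
    aT p t - (volume ({x | t < p x} \ Ioi (aT p t))).toReal < x}).toReal

/-- `Ω(x) = ∫_{-∞}^x w`. -/
def Om (w : ℝ → ℝ) (x : ℝ) : ℝ := ∫ z in Iic x, w z

/-- The kernel `V(x) = ∫_{-∞}^x Ω`. -/
def Vker (w : ℝ → ℝ) (x : ℝ) : ℝ := ∫ z in Iic x, Om w z

/-- `κ(x) = V(x) - x Ω(x)`. -/
def kap (w : ℝ → ℝ) (x : ℝ) : ℝ := Vker w x - x * Om w x

/-- Right-continuous generalized inverse of a profile. -/
def rinv (p : ℝ → ℝ) (u : ℝ) : ℝ := sInf {x | u < p x}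

/-- Displacement interpolant of two nondecreasing interpolating profiles. -/
def dispInterp (p0 p1 : ℝ → ℝ) (l x : ℝ) : ℝ :=
  sInf {u | u ∈ Ioo (0:ℝ) 1 ∧ x < (1 - l) * rinv p0 u + l * rinv p1 u}

/-- A profile saturated off of the interval [-K,K]. -/
def Saturated (f : ℝ → ℝ) (K : ℝ) : Prop :=
  (∀ x, x < -K → f x = 0) ∧ (∀ x, K < x → f x = 1)

/-- Consistent fixed point. -/
def IsCFP (w hf hg f g : ℝ → ℝ) : Prop :=
  ∀ x, f x ∈ Icc (Function.leftLim hf (convw g w x)) (Function.rightLim hf (convw g w x)) ∧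
       g x ∈ Icc (Function.leftLim hg (convw f w x)) (Function.rightLim hg (convw f w x))

/-- Interval support condition with parameter `W ∈ (0,∞]`. -/
def IntervalSupport (w : ℝ → ℝ) (W : ℝ≥0∞) : Prop :=
  ∀ x : ℝ, (ENNReal.ofReal |x| < W → 0 < w x) ∧ (W < ENNReal.ofReal |x| → w x = 0)

/-- The functional `L(f,g)`. -/
def Lfun (hf hg f g : ℝ → ℝ) : ℝ :=
  ∫ x, ((∫ v in (0:ℝ)..f x, geninv hf v) - ∫ u in (0:ℝ)..g x, (1 - geninv hg u))

theorem Om_sub {w : ℝ → ℝ} (hw : IsWindow w) {x y : ℝ} (hxy : x ≤ y) :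
    Om w y - Om w x = ∫ z in Ioc x y, w z := by
  rw [Om, Om, intervalIntegral.integral_Iic_sub_Iic hw.integrable.integrableOn
    hw.integrable.integrableOn, intervalIntegral.integral_of_le hxy]

theorem Om_mono {w : ℝ → ℝ} (hw : IsWindow w) : Monotone (Om w) := by
  intro x y hxy
  have h : 0 ≤ ∫ z in Ioc x y, w z := integral_nonneg fun z => hw.nonneg z
  linarith [Om_sub hw hxy]

theorem Om_continuous {w : ℝ → ℝ} (hw : IsWindow w) : Continuous (Om w) := by
  have h : Om w = fun x => Om w 0 + ∫ z in (0:ℝ)..x, w z := by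
    funext x
    rw [← intervalIntegral.integral_Iic_sub_Iic hw.integrable.integrableOn
      hw.integrable.integrableOn, Om, Om]
    ring
  rw [h]
  exact continuous_const.add
    (intervalIntegral.continuous_primitive (fun a b => hw.integrable.intervalIntegrable) 0)

theorem Om_mem_Icc {w : ℝ → ℝ} (hw : IsWindow w) (x : ℝ) : Om w x ∈ Icc (0:ℝ) 1 := by
  refine ⟨integral_nonneg fun z => hw.nonneg z, ?_⟩
  rw [← hw.normalized]
  exact setIntegral_le_integral hw.integrable (ae_of_all _ hw.nonneg)

theorem Om_neg {w : ℝ → ℝ} (hw : IsWindow w) (x : ℝ) : Om w (-x) = 1 - Om w x := by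
  have h1 : Om w (-x) = ∫ z in Ioi x, w z := by
    rw [Om, ← integral_comp_neg_Ioi]
    simp [hw.even]
  have h2 := intervalIntegral.integral_Iic_add_Ioi (b := x) hw.integrable.integrableOn
    hw.integrable.integrableOn
  rw [hw.normalized] at h2
  rw [h1, Om]
  linarith

/-- `Ω` can only be constant on an interval lying off the support of the window. -/
theorem le_of_Om_eq {w : ℝ → ℝ} {W : ℝ≥0∞} (hw : IsWindow w) (hsup : IntervalSupport w W)
    {x y z : ℝ} (hxy : x < y) (hz : z ∈ Icc x y) (h : Om w x = Om w y) :
    W ≤ ENNReal.ofReal |z| := by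
  by_contra! hlt
  have hint : ∫ t in Ioc x y, w t = 0 := by rw [← Om_sub hw hxy.le, h, sub_self]
  rw [integral_eq_zero_iff_of_nonneg hw.nonneg hw.integrable.integrableOn] at hint
  have hopen : IsOpen {t : ℝ | ENNReal.ofReal |t| < W} :=
    isOpen_lt (ENNReal.continuous_ofReal.comp continuous_abs) continuous_const
  have hne : ({t : ℝ | ENNReal.ofReal |t| < W} ∩ Ioo x y).Nonempty := by
    rw [← closure_Ioo hxy.ne] at hz
    exact mem_closure_iff.1 hz _ hopen hlt
  have hpos := (hopen.inter isOpen_Ioo).measure_pos volume hne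
  refine hpos.ne' (measure_mono_null ?_ ((ae_restrict_iff' measurableSet_Ioc).1 hint))
  rintro t ⟨ht, htxy⟩ himp
  exact ((hsup t).1 ht).ne' (himp (Ioo_subset_Ioc_self htxy))

theorem rinv_set_nonempty {p : ℝ → ℝ} (hp : IsProfile p) {u : ℝ} (hu : u < 1) :
    {x | u < p x}.Nonempty :=
  (hp.2.2.eventually (lt_mem_nhds hu)).exists

theorem rinv_set_bddBelow {p : ℝ → ℝ} (hp : IsProfile p) {u : ℝ} (hu : 0 < u)
    (hm : Monotone p) : BddBelow {x | u < p x} := by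
  obtain ⟨b, hb⟩ := (hp.2.1.eventually (gt_mem_nhds hu)).exists
  refine ⟨b, fun x hx => ?_⟩
  by_contra! h
  exact absurd (hm h.le) (not_le.2 (hb.trans hx))

theorem lt_of_rinv_lt {p : ℝ → ℝ} (hp : IsProfile p) (hm : Monotone p) {u x : ℝ}
    (hu : u < 1) (h : rinv p u < x) : u < p x := by
  obtain ⟨y, hy, hyx⟩ := exists_lt_of_csInf_lt (rinv_set_nonempty hp hu) h
  exact lt_of_lt_of_le hy (hm hyx.le)

theorem le_of_lt_rinv {p : ℝ → ℝ} (hp : IsProfile p) (hm : Monotone p) {u x : ℝ}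
    (hu : 0 < u) (h : x < rinv p u) : p x ≤ u := by
  by_contra! hlt
  exact absurd (csInf_le (rinv_set_bddBelow hp hu hm) hlt) (not_le.2 h)

theorem rinv_monotoneOn {p : ℝ → ℝ} (hp : IsProfile p) (hm : Monotone p) :
    MonotoneOn (rinv p) (Ioo 0 1) := fun _u hu _v hv huv =>
  csInf_le_csInf (rinv_set_bddBelow hp hu.1 hm) (rinv_set_nonempty hp hv.2)
    fun _x hx => lt_of_le_of_lt huv hx

theorem rinv_aemeasurable {p : ℝ → ℝ} (hp : IsProfile p) (hm : Monotone p) :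
    AEMeasurable (rinv p) (volume.restrict (Ioo 0 1)) :=
  aemeasurable_restrict_of_monotoneOn measurableSet_Ioo (rinv_monotoneOn hp hm)

/-- Layer-cake formula for the convolution of a monotone profile with the window. -/
theorem convw_eq_integral_Om {w p : ℝ → ℝ} (hw : IsWindow w) (hp : IsProfile p)
    (hm : Monotone p) (x : ℝ) :
    convw p w x = ∫ u in Ioo (0:ℝ) 1, Om w (x - rinv p u) := by
  set μ : Measure ℝ := volume.restrict (Ioo 0 1) with hμ
  set S : Set (ℝ × ℝ) := {q | q.2 < p q.1} with hS
  have hSm : MeasurableSet S := measurableSet_lt measurable_snd (hm.measurable.comp measurable_fst)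
  have hwx : Integrable (fun y => w (x - y)) := hw.integrable.comp_sub_left x
  have hint : Integrable (S.indicator fun q : ℝ × ℝ => w (x - q.1)) (volume.prod μ) :=
    (hwx.comp_fst μ).indicator hSm
  have hleft : ∀ y, ∫ u, S.indicator (fun q : ℝ × ℝ => w (x - q.1)) (y, u) ∂μ
      = p y * w (x - y) := by
    intro y
    have h1 : (fun u => S.indicator (fun q : ℝ × ℝ => w (x - q.1)) (y, u))
        = (Iio (p y)).indicator fun _ => w (x - y) := by
      funext u
      by_cases h : u < p y <;> simp [hS, h]
    rw [h1, integral_indicator_const _ measurableSet_Iio, hμ,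
      measureReal_restrict_apply measurableSet_Iio, smul_eq_mul]
    congr 1
    have h2 : Iio (p y) ∩ Ioo 0 1 = Ioo 0 (p y) := by
      ext u
      have := (hp.1 y).2
      simp only [mem_inter_iff, mem_Iio, mem_Ioo]
      constructor
      · rintro ⟨a, b, -⟩; exact ⟨b, a⟩
      · rintro ⟨a, b⟩; exact ⟨b, a, by linarith⟩
    rw [h2, Real.volume_real_Ioo_of_le (hp.1 y).1, sub_zero]
  have hright : ∀ u ∈ Ioo (0:ℝ) 1,
      ∫ y, S.indicator (fun q : ℝ × ℝ => w (x - q.1)) (y, u) = Om w (x - rinv p u) := by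
    intro u hu
    have h1 : (fun y => S.indicator (fun q : ℝ × ℝ => w (x - q.1)) (y, u))
        =ᵐ[volume] (Ioi (rinv p u)).indicator fun y => w (x - y) := by
      filter_upwards [compl_mem_ae_iff.2 (measure_singleton (μ := volume) (rinv p u))] with y hy
      rcases lt_or_gt_of_ne (show y ≠ rinv p u from hy) with h | h
      · have := le_of_lt_rinv hp hm hu.1 h
        simp [hS, h.le, this]
      · have := lt_of_rinv_lt hp hm hu.2 h
        simp [hS, h, this]
    rw [integral_congr_ae h1, Om, ← integral_indicator measurableSet_Iic,
      ← integral_sub_left_eq_self ((Iic (x - rinv p u)).indicator w) volume x]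
    refine integral_congr_ae ?_
    filter_upwards [compl_mem_ae_iff.2 (measure_singleton (μ := volume) (rinv p u))] with y hy
    rcases lt_or_gt_of_ne (show y ≠ rinv p u from hy) with h | h
    · have h2 : x - y ∉ Iic (x - rinv p u) := fun h3 => by linarith [mem_Iic.1 h3]
      rw [indicator_of_notMem (notMem_Ioi.2 h.le), indicator_of_notMem h2]
    · have h2 : x - y ∈ Iic (x - rinv p u) := mem_Iic.2 (by linarith)
      rw [indicator_of_mem (mem_Ioi.2 h), indicator_of_mem h2]
  calc convw p w x = ∫ y, ∫ u, S.indicator (fun q : ℝ × ℝ => w (x - q.1)) (y, u) ∂μ := by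
        simp only [convw, hleft]
    _ = ∫ u, (∫ y, S.indicator (fun q : ℝ × ℝ => w (x - q.1)) (y, u)) ∂μ :=
        integral_integral_swap
          (f := fun y u => S.indicator (fun q : ℝ × ℝ => w (x - q.1)) (y, u)) hint
    _ = _ := setIntegral_congr_fun measurableSet_Ioo hright

theorem Om_integrable {w p : ℝ → ℝ} (hw : IsWindow w) (hp : IsProfile p)
    (hm : Monotone p) (x : ℝ) :
    Integrable (fun u => Om w (x - rinv p u)) (volume.restrict (Ioo 0 1)) := by
  refine Integrable.of_bound (C := 1) ?_ (ae_of_all _ fun u => ?_)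
  · exact ((Om_continuous hw).measurable.comp_aemeasurable
      ((rinv_aemeasurable hp hm).const_sub x)).aestronglyMeasurable
  · have := Om_mem_Icc hw (x - rinv p u)
    rw [Real.norm_eq_abs, abs_of_nonneg this.1]
    exact this.2

theorem convw_monotone {w p : ℝ → ℝ} (hw : IsWindow w) (hp : IsProfile p)
    (hm : Monotone p) : Monotone (convw p w) := by
  intro x y hxy
  rw [convw_eq_integral_Om hw hp hm, convw_eq_integral_Om hw hp hm]
  exact integral_mono (Om_integrable hw hp hm x) (Om_integrable hw hp hm y)
    fun u => Om_mono hw (by linarith)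

theorem convw_continuous {w p : ℝ → ℝ} (hw : IsWindow w) (hp : IsProfile p)
    (hm : Monotone p) : Continuous (convw p w) := by
  rw [funext (convw_eq_integral_Om hw hp hm)]
  refine continuous_of_dominated (bound := fun _ => 1)
    (fun x => (Om_integrable hw hp hm x).aestronglyMeasurable) (fun x => ae_of_all _ fun u => ?_)
    (integrable_const _) (ae_of_all _ fun u => (Om_continuous hw).comp (by fun_prop))
  have := Om_mem_Icc hw (x - rinv p u)
  rw [Real.norm_eq_abs, abs_of_nonneg this.1]
  exact this.2

theorem convw_mem_Icc {w p : ℝ → ℝ} (hw : IsWindow w) (hp : IsProfile p)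
    (hm : Monotone p) (x : ℝ) : convw p w x ∈ Icc (0:ℝ) 1 := by
  rw [convw_eq_integral_Om hw hp hm]
  refine ⟨integral_nonneg fun u => (Om_mem_Icc hw _).1, ?_⟩
  calc _ ≤ ∫ u in Ioo (0:ℝ) 1, (1:ℝ) :=
        integral_mono (Om_integrable hw hp hm x) (integrable_const _)
          fun u => (Om_mem_Icc hw _).2
    _ = 1 := by simp

theorem rightLim_le_of_monotoneOn {h : ℝ → ℝ} (hh : MonotoneOn h (Icc (0:ℝ) 1)) {s t : ℝ}
    (hs : 0 ≤ s) (ht : t ≤ 1) (hst : s < t) : Function.rightLim h s ≤ h t := by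
  have hlim := hh.mono (Ioc_subset_Icc_self.trans (Icc_subset_Icc hs ht))
  have hb : BddBelow (h '' Ioc s t) := by
    refine ⟨h s, ?_⟩
    rintro _ ⟨y, hy, rfl⟩
    exact hh ⟨hs, hst.le.trans ht⟩ ⟨hs.trans hy.1.le, hy.2.trans ht⟩ hy.1.le
  have htend : Tendsto h (nhdsWithin s (Ioi s)) (nhds (sInf (h '' Ioo s t))) :=
    MonotoneOn.tendsto_nhdsWithin_Ioo_right (nonempty_Ioo.2 hst)
      (hlim.mono Ioo_subset_Ioc_self) (hb.mono (image_mono Ioo_subset_Ioc_self))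
  rw [rightLim_eq_of_tendsto htend]
  obtain ⟨y, hy⟩ := nonempty_Ioo.2 hst
  exact (csInf_le (hb.mono (image_mono Ioo_subset_Ioc_self)) ⟨y, hy, rfl⟩).trans
    (hlim ⟨hy.1, hy.2.le⟩ ⟨hst, le_rfl⟩ hy.2.le)

theorem le_leftLim_of_monotoneOn {h : ℝ → ℝ} (hh : MonotoneOn h (Icc (0:ℝ) 1)) {s t : ℝ}
    (hs : 0 ≤ s) (ht : t ≤ 1) (hst : s < t) : h s ≤ Function.leftLim h t := by
  have hlim := hh.mono (Ico_subset_Icc_self.trans (Icc_subset_Icc hs ht))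
  have hb : BddAbove (h '' Ico s t) := by
    refine ⟨h t, ?_⟩
    rintro _ ⟨y, hy, rfl⟩
    exact hh ⟨hs.trans hy.1, hy.2.le.trans ht⟩ ⟨hs.trans hst.le, ht⟩ hy.2.le
  have htend : Tendsto h (nhdsWithin t (Iio t)) (nhds (sSup (h '' Ioo s t))) :=
    MonotoneOn.tendsto_nhdsWithin_Ioo_left (nonempty_Ioo.2 hst)
      (hlim.mono Ioo_subset_Ico_self) (hb.mono (image_mono Ioo_subset_Ico_self))
  rw [leftLim_eq_of_tendsto htend]
  obtain ⟨y, hy⟩ := nonempty_Ioo.2 hst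
  exact (hlim ⟨le_rfl, hst⟩ ⟨hy.1.le, hy.2⟩ hy.1.le).trans
    (le_csSup (hb.mono (image_mono Ioo_subset_Ico_self)) ⟨y, hy, rfl⟩)

/-- The fixed point equation `f ∈ [h(g^w -), h(g^w +)]` in terms of inverse functions. -/
theorem convw_rinv_eq_geninv {w h f g : ℝ → ℝ} (hw : IsWindow w) (hh : IsUpdate h)
    (hf : IsProfile f) (hfm : Monotone f) (hg : IsProfile g) (hgm : Monotone g)
    (hfix : ∀ x, f x ∈ Icc (Function.leftLim h (convw g w x)) (Function.rightLim h (convw g w x)))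
    {v : ℝ} (hv : v ∈ Ioo (0:ℝ) 1) : convw g w (rinv f v) = geninv h v := by
  set x := rinv f v
  have hmem := convw_mem_Icc hw hg hgm
  have hcont := (convw_continuous hw hg hgm).continuousAt (x := x)
  refine le_antisymm ?_ ?_
  · refine le_csInf ⟨1, by simp, by rw [hh.2.2.2]; exact hv.2⟩ ?_
    rintro s ⟨hs, hvs⟩
    by_contra! hlt
    obtain ⟨y, hyx, hsy⟩ : ∃ y < x, s < convw g w y := by
      have := (hcont.eventually (lt_mem_nhds hlt)).filter_mono (nhdsWithin_le_nhds (s := Iio x))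
      obtain ⟨y, h1, h2⟩ := (this.and self_mem_nhdsWithin).exists
      exact ⟨y, h2, h1⟩
    have h1 := le_leftLim_of_monotoneOn hh.1 hs.1 (hmem y).2 hsy
    have h2 := le_of_lt_rinv hf hfm hv.1 hyx
    linarith [(hfix y).1]
  · have hbdd : BddBelow {s | s ∈ Icc (0:ℝ) 1 ∧ v < h s} := ⟨0, fun s hs => hs.1.1⟩
    refine le_of_forall_gt_imp_ge_of_dense fun s hs => ?_
    rcases le_or_gt 1 s with h1s | hs1
    · exact (csInf_le hbdd ⟨by simp, by rw [hh.2.2.2]; exact hv.2⟩).trans h1s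
    obtain ⟨y, hxy, hys⟩ : ∃ y > x, convw g w y < s := by
      have := (hcont.eventually (gt_mem_nhds hs)).filter_mono (nhdsWithin_le_nhds (s := Ioi x))
      obtain ⟨y, h1, h2⟩ := (this.and self_mem_nhdsWithin).exists
      exact ⟨y, h2, h1⟩
    have h1 := rightLim_le_of_monotoneOn hh.1 (hmem y).1 hs1.le hys
    have h2 := lt_of_rinv_lt hf hfm hv.2 hxy
    exact csInf_le hbdd ⟨⟨(hmem y).1.trans hys.le, hs1.le⟩, by linarith [(hfix y).2]⟩

theorem integral_Om_sub_rinv {w h f g : ℝ → ℝ} (hw : IsWindow w) (hh : IsUpdate h)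
    (hf : IsProfile f) (hfm : Monotone f) (hg : IsProfile g) (hgm : Monotone g)
    (hfix : ∀ x, f x ∈ Icc (Function.leftLim h (convw g w x)) (Function.rightLim h (convw g w x)))
    {v : ℝ} (hv : v ∈ Ioo (0:ℝ) 1) :
    ∫ u in Ioo (0:ℝ) 1, Om w (rinv f v - rinv g u) = geninv h v := by
  rw [← convw_eq_integral_Om hw hg hgm, convw_rinv_eq_geninv hw hh hf hfm hg hgm hfix hv]

/-- A bounded kernel with vanishing marginals that has the sign of `α v - β u` vanishes
almost everywhere on `{α v ≠ β u}`. -/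
theorem ae_eq_zero_of_marginals {μ : Measure ℝ} [IsFiniteMeasure μ] {K : ℝ × ℝ → ℝ}
    {α β : ℝ → ℝ} (hα : AEMeasurable α μ) (hβ : AEMeasurable β μ)
    (hK : Integrable K (μ.prod μ)) (hsign : ∀ q, 0 ≤ K q * (α q.2 - β q.1))
    (h1 : ∀ᵐ v ∂μ, ∫ u, K (u, v) ∂μ = 0) (h2 : ∀ᵐ u ∂μ, ∫ v, K (u, v) ∂μ = 0) :
    ∀ᵐ q ∂(μ.prod μ), α q.2 ≠ β q.1 → K q = 0 := by
  have hbound : ∀ t, ‖Real.arctan t‖ ≤ Real.pi / 2 := fun t => by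
    rw [Real.norm_eq_abs, abs_le]
    exact ⟨(Real.neg_pi_div_two_lt_arctan t).le, (Real.arctan_lt_pi_div_two t).le⟩
  have hiα : Integrable (fun q : ℝ × ℝ => Real.arctan (α q.2) * K q) (μ.prod μ) :=
    hK.bdd_mul (Real.measurable_arctan.comp_aemeasurable hα.comp_snd).aestronglyMeasurable
      (ae_of_all _ fun q => hbound _)
  have hiβ : Integrable (fun q : ℝ × ℝ => Real.arctan (β q.1) * K q) (μ.prod μ) :=
    hK.bdd_mul (Real.measurable_arctan.comp_aemeasurable hβ.comp_fst).aestronglyMeasurable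
      (ae_of_all _ fun q => hbound _)
  have hzα : ∫ q, Real.arctan (α q.2) * K q ∂(μ.prod μ) = 0 := by
    rw [integral_prod_symm _ hiα]
    refine integral_eq_zero_of_ae ?_
    filter_upwards [h1] with v hv
    simp only [integral_const_mul, hv, mul_zero, Pi.zero_apply]
  have hzβ : ∫ q, Real.arctan (β q.1) * K q ∂(μ.prod μ) = 0 := by
    rw [integral_prod _ hiβ]
    refine integral_eq_zero_of_ae ?_
    filter_upwards [h2] with u hu
    simp only [integral_const_mul, hu, mul_zero, Pi.zero_apply]
  have hnn : ∀ q : ℝ × ℝ, 0 ≤ Real.arctan (α q.2) * K q - Real.arctan (β q.1) * K q := by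
    intro q
    rw [← sub_mul]
    rcases lt_trichotomy (α q.2) (β q.1) with h | h | h
    · have hK0 : K q ≤ 0 := by
        by_contra! hc
        nlinarith [hsign q]
      exact mul_nonneg_of_nonpos_of_nonpos
        (sub_nonpos.2 (Real.arctan_strictMono h).le) hK0
    · simp [h]
    · have hK0 : 0 ≤ K q := by
        by_contra! hc
        nlinarith [hsign q]
      exact mul_nonneg (sub_nonneg.2 (Real.arctan_strictMono h).le) hK0
  have hz := integral_sub hiα hiβ
  rw [hzα, hzβ, sub_zero, integral_eq_zero_iff_of_nonneg hnn (hiα.sub hiβ)] at hz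
  filter_upwards [hz] with q hq hne
  rw [← sub_mul] at hq
  refine (mul_eq_zero.1 hq).resolve_left (sub_ne_zero.2 fun h => hne ?_)
  exact Real.arctan_strictMono.injective h

/-- Under the PGC, `C_w < ∞` and the interval support condition with
parameter `W`, if `(f₀,g₀)` and `(f₁,g₁)` are consistent fixed points of nondecreasing
interpolating profiles, then for every `λ ∈ [0,1]` the set
`{(u,v) ∈ (0,1)² : |f_λ⁻¹(v) - g_λ⁻¹(u)| < W, D(u,v) ≠ 0, φ(u,v) ≠ 0}` has
two-dimensional Lebesgue measure zero, where
`D(u,v) = (f₁⁻¹(v) - g₁⁻¹(u)) - (f₀⁻¹(v) - g₀⁻¹(u))`. -/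
theorem stmt15 (w hf hg f0 g0 f1 g1 : ℝ → ℝ) (W : ℝ≥0∞) (hW : 0 < W)
    (hw : IsWindow w) (hCw : Integrable (fun x => |x| * w x))
    (hsup : IntervalSupport w W)
    (hhf : IsUpdate hf) (hhg : IsUpdate hg) (hpgc : PGC hf hg)
    (hf0 : IsProfile f0) (hg0 : IsProfile g0) (hf1 : IsProfile f1) (hg1 : IsProfile g1)
    (hf0m : Monotone f0) (hg0m : Monotone g0) (hf1m : Monotone f1) (hg1m : Monotone g1)
    (hcfp0 : IsCFP w hf hg f0 g0) (hcfp1 : IsCFP w hf hg f1 g1)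
    (l : ℝ) (hl : l ∈ Icc (0:ℝ) 1) :
    volume {p : ℝ × ℝ | p.1 ∈ Ioo (0:ℝ) 1 ∧ p.2 ∈ Ioo (0:ℝ) 1 ∧
      ENNReal.ofReal |((1 - l) * rinv f0 p.2 + l * rinv f1 p.2) -
        ((1 - l) * rinv g0 p.1 + l * rinv g1 p.1)| < W ∧
      (rinv f1 p.2 - rinv g1 p.1) - (rinv f0 p.2 - rinv g0 p.1) ≠ 0 ∧
      pot hf hg p.1 p.2 ≠ 0} = 0 := by
  set μ : Measure ℝ := volume.restrict (Ioo 0 1) with hμ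
  have hprod : μ.prod μ = (volume : Measure (ℝ × ℝ)).restrict (Ioo 0 1 ×ˢ Ioo 0 1) := by
    rw [hμ, Measure.prod_restrict, Measure.volume_eq_prod]
  have hmono := Om_mono hw
  have hKint : ∀ {f g : ℝ → ℝ}, IsProfile f → Monotone f → IsProfile g → Monotone g →
      Integrable (fun q : ℝ × ℝ => Om w (rinv f q.2 - rinv g q.1)) (μ.prod μ) := by
    intro f g hf hfm hg hgm
    refine Integrable.of_bound (C := 1) ?_ (ae_of_all _ fun q => ?_)
    · exact ((Om_continuous hw).measurable.comp_aemeasurable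
        ((rinv_aemeasurable hf hfm).comp_snd.sub
          (rinv_aemeasurable hg hgm).comp_fst)).aestronglyMeasurable
    · have := Om_mem_Icc hw (rinv f q.2 - rinv g q.1)
      rw [Real.norm_eq_abs, abs_of_nonneg this.1]
      exact this.2
  have hreflect : ∀ {f : ℝ → ℝ}, IsProfile f → Monotone f → ∀ b : ℝ,
      ∫ v, Om w (rinv f v - b) ∂μ = 1 - ∫ v, Om w (b - rinv f v) ∂μ := by
    intro f hf hfm b
    have h1 : ∀ v, Om w (rinv f v - b) = 1 - Om w (b - rinv f v) := fun v => by
      rw [← Om_neg hw, neg_sub]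
    simp only [h1]
    rw [integral_sub (integrable_const _) (Om_integrable hw hf hfm b)]
    simp [hμ]
  have hslice : ∀ {f : ℝ → ℝ}, IsProfile f → Monotone f → ∀ b : ℝ,
      Integrable (fun v => Om w (rinv f v - b)) μ := by
    intro f hf hfm b
    have h1 : (fun v => Om w (rinv f v - b)) = fun v => 1 - Om w (b - rinv f v) := by
      funext v
      rw [← Om_neg hw, neg_sub]
    rw [h1]
    exact (integrable_const _).sub (Om_integrable hw hf hfm b)
  have key := ae_eq_zero_of_marginals (μ := μ)
    (K := fun q => Om w (rinv f1 q.2 - rinv g1 q.1) - Om w (rinv f0 q.2 - rinv g0 q.1))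
    (α := fun v => rinv f1 v - rinv f0 v) (β := fun u => rinv g1 u - rinv g0 u)
    ((rinv_aemeasurable hf1 hf1m).sub (rinv_aemeasurable hf0 hf0m))
    ((rinv_aemeasurable hg1 hg1m).sub (rinv_aemeasurable hg0 hg0m))
    ((hKint hf1 hf1m hg1 hg1m).sub (hKint hf0 hf0m hg0 hg0m)) ?_ ?_ ?_
  · rw [hprod, ae_restrict_iff' (measurableSet_Ioo.prod measurableSet_Ioo)] at key
    refine measure_mono_null ?_ key
    rintro ⟨u, v⟩ ⟨hu, hv, hlt, hD, -⟩ himp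
    have heq := himp ⟨hu, hv⟩ fun h => hD (by dsimp only at h ⊢; linarith)
    dsimp only at heq hlt hD
    obtain ⟨hl0, hl1⟩ := hl
    set A := rinv f1 v - rinv g1 u
    set B := rinv f0 v - rinv g0 u
    have hz : ((1 - l) * rinv f0 v + l * rinv f1 v) - ((1 - l) * rinv g0 u + l * rinv g1 u)
        = B + l * (A - B) := by ring
    rw [hz] at hlt
    refine absurd hlt (not_lt.2 ?_)
    rcases lt_or_gt_of_ne (sub_ne_zero.1 hD) with h | h
    · exact le_of_Om_eq hw hsup h ⟨by nlinarith, by nlinarith⟩ (by linarith)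
    · exact le_of_Om_eq hw hsup h ⟨by nlinarith, by nlinarith⟩ (by linarith)
  · intro q
    rcases le_total (rinv f1 q.2 - rinv g1 q.1) (rinv f0 q.2 - rinv g0 q.1) with h | h
    · exact mul_nonneg_of_nonpos_of_nonpos (sub_nonpos.2 (hmono h)) (by linarith)
    · exact mul_nonneg (sub_nonneg.2 (hmono h)) (by linarith)
  · refine (ae_restrict_iff' measurableSet_Ioo).2 (ae_of_all _ fun v hv => ?_)
    dsimp only
    rw [integral_sub (Om_integrable hw hg1 hg1m _) (Om_integrable hw hg0 hg0m _),
      integral_Om_sub_rinv hw hhf hf1 hf1m hg1 hg1m (fun x => (hcfp1 x).1) hv,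
      integral_Om_sub_rinv hw hhf hf0 hf0m hg0 hg0m (fun x => (hcfp0 x).1) hv, sub_self]
  · refine (ae_restrict_iff' measurableSet_Ioo).2 (ae_of_all _ fun u hu => ?_)
    dsimp only
    rw [integral_sub (hslice hf1 hf1m _) (hslice hf0 hf0m _), hreflect hf1 hf1m,
      hreflect hf0 hf0m,
      integral_Om_sub_rinv hw hhg hg1 hg1m hf1 hf1m (fun x => (hcfp1 x).2) hu,
      integral_Om_sub_rinv hw hhg hg0 hg0m hf0 hf0m (fun x => (hcfp0 x).2) hu, sub_self]

end
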